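/- arXiv:math/0601038 — 2 statements merged into one kernel-verified Lean document; each statement's English description precedes it below -/
import Mathlib

section
/- Let σ(x)² = αx² + βx + γ be nonnegative on ℝ with σ ∈ C¹, and let X_t = φ(x₀, B_t) solve X_t = x₀ + ∫_0^t σ(X_s) d∘B_s for fBm B with 1/6 < H < 1/2. If a random vector (B_1, G_n) with G_n = n^{3H−1/2} ∑_{k=0}^{n−1}(ΔB_{k/n})³ converges in law to (B_1, G) with G ~ N(0, σ_H²) independent of B_1, and if n^{3H−1/2}(R_n) → 0 in probability for the remainder terms R_n involving ∑(ΔB)⁵ and ∑(ΔB)⁶, then n^{3H−1/2}(X̂ⁿ_1 − X_1) converges in law to σ_H (α/12) σ(X_1) G, where X̂ⁿ is the Crank–Nicholson scheme. -/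
open MeasureTheory ProbabilityTheory Filter Finset

/-- Mean-value form of the increment of a flow with continuous derivative. -/
lemma incr_eq_mul_integral {ψ s : ℝ → ℝ} (hs : Continuous s)
    (hψ : ∀ y, HasDerivAt ψ (s y) y) (b h : ℝ) :
    ψ (b + h) - ψ b = h * ∫ t in (0:ℝ)..1, s (b + t * h) := by
  have hd : ∀ t ∈ Set.uIcc (0:ℝ) 1,
      HasDerivAt (fun t : ℝ => ψ (b + t * h)) (s (b + t * h) * h) t := by
    intro t _
    have h1 : HasDerivAt (fun t : ℝ => b + t * h) h t := by
      simpa using ((hasDerivAt_id t).mul_const h).const_add b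
    exact (hψ (b + t * h)).comp t h1
  have := intervalIntegral.integral_eq_sub_of_hasDerivAt hd
    (Continuous.intervalIntegrable (by fun_prop) _ _)
  rw [intervalIntegral.integral_mul_const] at this
  simp only [one_mul, zero_mul, add_zero] at this
  rw [← this, mul_comm]

/-- Analytic core of Theorem 3.5 (Crank–Nicholson scheme, quadratic `σ²`):
if `X̂ⁿ₁ = φ(x₀, B₁ + (α/12)S₃ⁿ + (α²/80)S₅ⁿ + Rₙ)` with `|Rₙ| ≤ C S₆ⁿ`-type remainder,
`(B₁, n^{3H-1/2} S₃ⁿ)` converges in law to `(B₁, G)` with `G ~ N(0, σ_H²)` independent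
of `B₁`, and the rescaled remainder terms tend to `0` in probability, then
`n^{3H-1/2}(X̂ⁿ₁ - X₁)` converges in law to `σ_H (α/12) σ(X₁) G'`, `G' ~ N(0,1)`
independent of `X₁`, where `X₁ = φ(x₀, B₁)` solves `X_t = x₀ + ∫₀ᵗ σ(X_s) d∘B_s`. -/
theorem stmt_14 {Ω : Type*} [MeasureSpace Ω] [IsProbabilityMeasure (ℙ : Measure Ω)]
    (H : ℝ) (hH : H ∈ Set.Ioo (1 / 6 : ℝ) (1 / 2))
    (σ : ℝ → ℝ) (hσ : ContDiff ℝ 1 σ)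
    (α β γ : ℝ) (hquad : ∀ x, σ x ^ 2 = α * x ^ 2 + β * x + γ)
    (x₀ : ℝ) (φ : ℝ → ℝ → ℝ) (hφ0 : φ x₀ 0 = x₀)
    (hφ : ∀ y : ℝ, HasDerivAt (φ x₀) (σ (φ x₀ y)) y)
    (B1 : Ω → ℝ) (hB1 : Measurable B1)
    (S3 S5 R : ℕ → Ω → ℝ)
    (hS3 : ∀ n, Measurable (S3 n)) (hS5 : ∀ n, Measurable (S5 n))
    (hR : ∀ n, Measurable (R n))
    (Xhat : ℕ → Ω → ℝ)
    (hXhat : ∀ n ω, Xhat n ω =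
      φ x₀ (B1 ω + α / 12 * S3 n ω + α ^ 2 / 80 * S5 n ω + R n ω))
    (vH : NNReal)
    (hjoint : ∀ F : BoundedContinuousFunction (ℝ × ℝ) ℝ,
      Tendsto
        (fun n : ℕ => ∫ ω, F (B1 ω, (n : ℝ) ^ (3 * H - 1 / 2) * S3 n ω) ∂ℙ)
        atTop
        (nhds (∫ ω, ∫ g, F (B1 ω, g) ∂(gaussianReal 0 vH) ∂ℙ)))
    (hrem5 : TendstoInMeasure ℙ
      (fun (n : ℕ) (ω : Ω) => (n : ℝ) ^ (3 * H - 1 / 2) * S5 n ω) atTop (fun _ => 0))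
    (hrem6 : TendstoInMeasure ℙ
      (fun (n : ℕ) (ω : Ω) => (n : ℝ) ^ (3 * H - 1 / 2) * R n ω) atTop (fun _ => 0)) :
    ∀ f : BoundedContinuousFunction ℝ ℝ,
      Tendsto
        (fun n : ℕ => ∫ ω, f ((n : ℝ) ^ (3 * H - 1 / 2) * (Xhat n ω - φ x₀ (B1 ω))) ∂ℙ)
        atTop
        (nhds (∫ ω, ∫ g, f (α / 12 * σ (φ x₀ (B1 ω)) * g) ∂(gaussianReal 0 vH) ∂ℙ)) := by
  intro f
  have hψc : Continuous (φ x₀) := continuous_iff_continuousAt.2 fun y => (hφ y).continuousAt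
  have hs : Continuous (fun y => σ (φ x₀ y)) := hσ.continuous.comp hψc
  have hp : 0 < 3 * H - 1 / 2 := by have := hH.1; linarith
  set a : ℕ → ℝ := fun n => (n : ℝ) ^ (3 * H - 1 / 2) with ha
  have ha_top : Tendsto a atTop atTop :=
    (tendsto_rpow_atTop hp).comp tendsto_natCast_atTop_atTop
  have hinv : Tendsto (fun n => (a n)⁻¹) atTop (nhds 0) := tendsto_inv_atTop_zero.comp ha_top
  -- joint convergence in distribution
  have h0 : TendstoInDistribution (fun (n : ℕ) ω => (B1 ω, a n * S3 n ω)) atTop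
      (fun p : Ω × ℝ => (B1 p.1, p.2)) (fun _ => (ℙ : Measure Ω))
      ((ℙ : Measure Ω).prod (gaussianReal 0 vH)) := by
    have hm : ∀ n, Measurable (fun ω => (B1 ω, a n * S3 n ω)) := fun n =>
      hB1.prodMk ((hS3 n).const_mul _)
    have hZ : Measurable (fun p : Ω × ℝ => (B1 p.1, p.2)) :=
      (hB1.comp measurable_fst).prodMk measurable_snd
    refine ⟨fun n => (hm n).aemeasurable, hZ.aemeasurable, ?_⟩
    refine ProbabilityMeasure.tendsto_iff_forall_integral_tendsto.2 ?_
    intro F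
    have hF := hjoint F
    simp only [ProbabilityMeasure.coe_mk]
    rw [integral_map hZ.aemeasurable F.continuous.aestronglyMeasurable, integral_prod]
    · refine hF.congr fun n => ?_
      rw [integral_map (hm n).aemeasurable F.continuous.aestronglyMeasurable]
    · exact Integrable.of_bound (F.continuous.measurable.comp hZ).aestronglyMeasurable ‖F‖
        (ae_of_all _ fun p => F.norm_coe_le_norm _)
  have h1 := h0.prodMk_of_tendstoInMeasure_const _ _ _ hrem5
    (fun n => ((hS5 n).const_mul _).aemeasurable)
  have h2 := h1.prodMk_of_tendstoInMeasure_const _ _ _ hrem6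
    (fun n => ((hR n).const_mul _).aemeasurable)
  have hinvm : TendstoInMeasure (ℙ : Measure Ω) (fun (n : ℕ) (_ : Ω) => (a n)⁻¹) atTop
      (fun _ => 0) :=
    tendstoInMeasure_of_tendsto_ae (fun n => aestronglyMeasurable_const)
      (ae_of_all _ fun _ => hinv)
  have h3 := h2.prodMk_of_tendstoInMeasure_const _ _ _ hinvm (fun n => aemeasurable_const)
  -- continuous mapping
  let U : (((ℝ × ℝ) × ℝ) × ℝ) × ℝ → ℝ := fun p =>
    α / 12 * p.1.1.1.2 + α ^ 2 / 80 * p.1.1.2 + p.1.2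
  have hU : Continuous U := by fun_prop
  let Ψ : (((ℝ × ℝ) × ℝ) × ℝ) × ℝ → ℝ := fun p =>
    U p * ∫ t in (0:ℝ)..1, σ (φ x₀ (p.1.1.1.1 + t * (U p * p.2)))
  have hΨ : Continuous Ψ := by
    refine hU.mul ?_
    refine intervalIntegral.continuous_parametric_intervalIntegral_of_continuous' ?_ 0 1
    refine hs.comp (f := fun q : ((((ℝ × ℝ) × ℝ) × ℝ) × ℝ) × ℝ =>
      q.1.1.1.1.1 + q.2 * (U q.1 * q.1.2)) ?_
    fun_prop
  have h4 := h3.continuous_comp hΨ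
  have h5 := (ProbabilityMeasure.tendsto_iff_forall_integral_tendsto.1 h4.tendsto) f
  simp only [ProbabilityMeasure.coe_mk] at h5
  rw [integral_map h4.aemeasurable_limit f.continuous.aestronglyMeasurable, integral_prod] at h5
  · have hlim : ∀ (ω : Ω) (g : ℝ), Ψ ((((B1 ω, g), 0), 0), 0)
        = α / 12 * σ (φ x₀ (B1 ω)) * g := by
      intro ω g
      simp [Ψ, U]
      ring
    simp only [Function.comp_apply, hlim] at h5
    refine h5.congr' ?_
    filter_upwards [ha_top.eventually_gt_atTop 0] with n hn
    rw [integral_map (h4.forall_aemeasurable n) f.continuous.aestronglyMeasurable]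
    refine integral_congr_ae (ae_of_all _ fun ω => ?_)
    have hne : a n ≠ 0 := hn.ne'
    show f (Ψ ((((B1 ω, a n * S3 n ω), a n * S5 n ω), a n * R n ω), (a n)⁻¹))
      = f (a n * (Xhat n ω - φ x₀ (B1 ω)))
    congr 1
    have hUe : U ((((B1 ω, a n * S3 n ω), a n * S5 n ω), a n * R n ω), (a n)⁻¹)
        = a n * (α / 12 * S3 n ω + α ^ 2 / 80 * S5 n ω + R n ω) := by
      simp only [U]; ring
    have hUi : a n * (α / 12 * S3 n ω + α ^ 2 / 80 * S5 n ω + R n ω) * (a n)⁻¹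
        = α / 12 * S3 n ω + α ^ 2 / 80 * S5 n ω + R n ω := by
      field_simp
    have hinc := incr_eq_mul_integral hs hφ (B1 ω)
      (α / 12 * S3 n ω + α ^ 2 / 80 * S5 n ω + R n ω)
    have harg : B1 ω + α / 12 * S3 n ω + α ^ 2 / 80 * S5 n ω + R n ω
        = B1 ω + (α / 12 * S3 n ω + α ^ 2 / 80 * S5 n ω + R n ω) := by ring
    rw [hXhat, harg, hinc]
    simp only [Ψ, hUe, hUi]
    ring
  · exact Integrable.of_bound
      (f.continuous.measurable.comp_aemeasurable h4.aemeasurable_limit).aestronglyMeasurable ‖f‖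
      (ae_of_all _ fun p => f.norm_coe_le_norm _)
end

section
/- Let m ∈ ℕ be even, h ∈ C¹_b(ℝ), H ∈ (0,1), and B a fractional Brownian motion with Hurst index H. Then n^{mH−1} ∑_{k=0}^{n−1} h(B_{k/n}) (B_{(k+1)/n} − B_{k/n})^m converges in probability, as n → ∞, to μ_m ∫_0^1 h(B_s) ds, where μ_m = m!/(2^{m/2} (m/2)!) is the m-th moment of a standard Gaussian. -/
open MeasureTheory ProbabilityTheory Filter Finset

namespace PV

/-- Even moments of the standard Gaussian. -/
lemma gaussian_moment (m : ℕ) (hm : Even m) :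
    ∫ x, x ^ m ∂(gaussianReal 0 1) =
      (m.factorial : ℝ) / (2 ^ (m / 2) * ((m / 2).factorial : ℝ)) := by
  obtain ⟨k, rfl⟩ := hm
  rw [← two_mul]
  rw [integral_gaussianReal_eq_integral_smul one_ne_zero]
  have h1 : ∀ x : ℝ, gaussianPDFReal 0 1 x • x ^ (2 * k) =
      (√(2 * Real.pi))⁻¹ * ((fun y : ℝ => y ^ ((2 * k : ℕ) : ℝ) *
        Real.exp (-(1/2) * y ^ (2 : ℝ))) |x|) := by
    intro x
    simp only [gaussianPDFReal, smul_eq_mul]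
    have : |x| ^ (2 * k) = x ^ (2 * k) := by rw [pow_mul, sq_abs, pow_mul]
    rw [Real.rpow_natCast, this, Real.rpow_two, sq_abs]
    have e : -(x - 0) ^ 2 / (2 * ((1 : NNReal) : ℝ)) = -(1/2) * x ^ 2 := by
      simp; ring
    rw [e]; simp only [NNReal.coe_one, mul_one]; ring
  simp_rw [h1]
  rw [integral_const_mul, integral_comp_abs (f := fun y : ℝ => y ^ ((2 * k : ℕ) : ℝ) *
        Real.exp (-(1/2) * y ^ (2 : ℝ))),
    integral_rpow_mul_exp_neg_mul_rpow (by norm_num)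
      (by have : (0:ℝ) ≤ ((2 * k : ℕ) : ℝ) := by positivity
          linarith) (by norm_num)]
  have e2 : (((2 * k : ℕ) : ℝ) + 1) / 2 = (k : ℝ) + 1 / 2 := by push_cast; ring
  have e3 : -(((2 * k : ℕ) : ℝ) + 1) / 2 = -((k : ℝ) + 1 / 2) := by push_cast; ring
  rw [e2, e3, Real.Gamma_nat_add_half]
  have e4 : ((1:ℝ)/2) ^ (-((k : ℝ) + 1 / 2)) = 2 ^ k * √2 := by
    rw [one_div, Real.inv_rpow (by norm_num), ← Real.rpow_neg (by norm_num), neg_neg,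
      Real.rpow_add (by norm_num), Real.rpow_natCast, Real.sqrt_eq_rpow, one_div]
  rw [e4]
  have e5 : 2 * k / 2 = k := by omega
  rw [e5]
  have e6 : ((2 * k).factorial : ℝ) = ((2 * k - 1).doubleFactorial : ℝ) * (2 ^ k * k.factorial) := by
    rcases k with _ | k
    · simp
    · have : 2 * (k + 1) = (2 * (k + 1) - 1) + 1 := by omega
      have h := Nat.factorial_eq_mul_doubleFactorial (2 * (k + 1) - 1)
      rw [← this, Nat.doubleFactorial_two_mul] at h
      rw [h]; push_cast; ring
  rw [e6, Real.sqrt_mul (by norm_num)]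
  have : √2 ≠ 0 := by positivity
  have : √Real.pi ≠ 0 := by have := Real.pi_pos; positivity
  have : (k.factorial : ℝ) ≠ 0 := by positivity
  field_simp

lemma cauchy_schwarz {Ω : Type*} {mΩ : MeasurableSpace Ω} {P : Measure Ω}
    {f g : Ω → ℝ} (hf : MemLp f 2 P) (hg : MemLp g 2 P) :
    ∫ ω, |f ω * g ω| ∂P ≤ √(∫ ω, f ω ^ 2 ∂P) * √(∫ ω, g ω ^ 2 ∂P) := by
  have := integral_mul_le_Lp_mul_Lq_of_nonneg (μ := P) (p := 2) (q := 2)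
    Real.HolderConjugate.two_two (f := fun ω => |f ω|) (g := fun ω => |g ω|)
    (by filter_upwards with x using abs_nonneg _) (by filter_upwards with x using abs_nonneg _)
    (by simpa using! hf.abs) (by simpa using! hg.abs)
  simpa [abs_mul, Real.sqrt_eq_rpow] using this

lemma l1_le_l2 {Ω : Type*} {mΩ : MeasurableSpace Ω} {P : Measure Ω} [IsProbabilityMeasure P]
    {f : Ω → ℝ} (hf : MemLp f 2 P) :
    ∫ ω, |f ω| ∂P ≤ √(∫ ω, f ω ^ 2 ∂P) := by
  simpa using cauchy_schwarz hf (memLp_const (1:ℝ) (μ := P) (p := 2))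

lemma integrable_pow {Ω : Type*} {mΩ : MeasurableSpace Ω} {P : Measure Ω}
    {X : Ω → ℝ} (hX : HasGaussianLaw X P) (j : ℕ) : Integrable (fun ω => X ω ^ j) P := by
  have := hX.isProbabilityMeasure
  rcases eq_or_ne j 0 with rfl | hj
  · simp
  have h := (hX.memLp (p := (j : ENNReal)) (by simp)).integrable_norm_pow hj
  refine h.mono' (hX.aemeasurable.pow_const j).aestronglyMeasurable ?_
  filter_upwards with ω
  simp

lemma memLp_pow {Ω : Type*} {mΩ : MeasurableSpace Ω} {P : Measure Ω}
    {X : Ω → ℝ} (hX : HasGaussianLaw X P) (j : ℕ) : MemLp (fun ω => X ω ^ j) 2 P := by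
  rw [memLp_two_iff_integrable_sq (hX.aemeasurable.pow_const j).aestronglyMeasurable]
  simpa [← pow_mul] using integrable_pow hX (j * 2)

lemma integral_pow_std {Ω : Type*} {mΩ : MeasurableSpace Ω} {P : Measure Ω}
    {X : Ω → ℝ} (hX : HasGaussianLaw X P) (h1 : P.map X = gaussianReal 0 1) (j : ℕ) :
    ∫ ω, X ω ^ j ∂P = ∫ x, x ^ j ∂(gaussianReal 0 1) := by
  rw [← h1, integral_map hX.aemeasurable (by fun_prop)]

/-- The constant in the covariance bound. -/
noncomputable def covConst (m : ℕ) : ℝ :=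
  (m : ℝ) * (1 + |∫ x, x ^ m ∂(gaussianReal 0 1)|) *
    (3 ^ (2 * m) * (1 + 2 * ∫ x, x ^ (2 * m) ∂(gaussianReal 0 1)))

lemma cov_bound {Ω : Type*} {mΩ : MeasurableSpace Ω} {P : Measure Ω}
    {X Y : Ω → ℝ} (hG : HasGaussianLaw (fun ω => (X ω, Y ω)) P)
    (hX1 : P.map X = gaussianReal 0 1) (hY1 : P.map Y = gaussianReal 0 1) (m : ℕ) :
    |∫ ω, (X ω ^ m - ∫ x, x ^ m ∂(gaussianReal 0 1)) *
      (Y ω ^ m - ∫ x, x ^ m ∂(gaussianReal 0 1)) ∂P| ≤ covConst m * |∫ ω, X ω * Y ω ∂P| := by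
  have hP := hG.isProbabilityMeasure
  have hX := hG.fst
  have hY := hG.snd
  set ρ := ∫ ω, X ω * Y ω ∂P with hρ
  set c := ∫ x, x ^ m ∂(gaussianReal 0 1) with hc
  set d := ∫ x, x ^ (2 * m) ∂(gaussianReal 0 1) with hd
  have hX0 : ∫ ω, X ω ∂P = 0 := by
    have := integral_pow_std hX hX1 1
    simpa [integral_id_gaussianReal] using this
  have hY0 : ∫ ω, Y ω ∂P = 0 := by
    have := integral_pow_std hY hY1 1
    simpa [integral_id_gaussianReal] using this
  have hm2 : ∫ x, x ^ 2 ∂(gaussianReal 0 1) = 1 := by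
    rw [gaussian_moment 2 (by decide)]; norm_num [Nat.factorial]
  have hXX : ∫ ω, X ω ^ 2 ∂P = 1 := by rw [integral_pow_std hX hX1, hm2]
  have hYY : ∫ ω, Y ω ^ 2 ∂P = 1 := by rw [integral_pow_std hY hY1, hm2]
  have iXY : Integrable (fun ω => X ω * Y ω) P := hX.memLp_two.integrable_mul hY.memLp_two
  have iX2 := integrable_pow hX 2
  have iY2 := integrable_pow hY 2
  have hρ1 : |ρ| ≤ 1 := by
    have h1 : 0 ≤ ∫ ω, (X ω + Y ω) ^ 2 ∂P := integral_nonneg fun ω => sq_nonneg _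
    have h2 : 0 ≤ ∫ ω, (X ω - Y ω) ^ 2 ∂P := integral_nonneg fun ω => sq_nonneg _
    have e1 : ∫ ω, (X ω + Y ω) ^ 2 ∂P = 1 + 1 + 2 * ρ := by
      have hs : ∀ ω, (X ω + Y ω) ^ 2 = (X ω ^ 2 + Y ω ^ 2) + 2 * (X ω * Y ω) := fun ω => by ring
      have iS : Integrable (fun ω => X ω ^ 2 + Y ω ^ 2) P := iX2.add iY2
      simp_rw [hs]
      rw [integral_add iS (iXY.const_mul 2), integral_add iX2 iY2, integral_const_mul, hXX, hYY]
    have e2 : ∫ ω, (X ω - Y ω) ^ 2 ∂P = 1 + 1 - 2 * ρ := by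
      have hs : ∀ ω, (X ω - Y ω) ^ 2 = (X ω ^ 2 + Y ω ^ 2) - 2 * (X ω * Y ω) := fun ω => by ring
      have iS : Integrable (fun ω => X ω ^ 2 + Y ω ^ 2) P := iX2.add iY2
      simp_rw [hs]
      rw [integral_sub iS (iXY.const_mul 2), integral_add iX2 iY2, integral_const_mul, hXX, hYY]
    rw [abs_le]; constructor <;> linarith
  let L : ℝ × ℝ →L[ℝ] ℝ × ℝ :=
    (ContinuousLinearMap.fst ℝ ℝ ℝ).prod
      (ContinuousLinearMap.snd ℝ ℝ ℝ - ρ • ContinuousLinearMap.fst ℝ ℝ ℝ)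
  let Z : Ω → ℝ := fun ω => Y ω - ρ * X ω
  have hXZ : HasGaussianLaw (fun ω => (X ω, Z ω)) P := by
    have := hG.map_fun L
    simpa [L, Z] using this
  have hZ := hXZ.snd
  have hcov : cov[X, Z; P] = 0 := by
    rw [covariance_eq_sub hX.memLp_two hZ.memLp_two, hX0, zero_mul, sub_zero]
    have : ∫ ω, (X * Z) ω ∂P = ∫ ω, (X ω * Y ω - ρ * X ω ^ 2) ∂P := by
      congr 1; ext ω; simp [Z]; ring
    rw [this, integral_sub iXY (iX2.const_mul ρ), integral_const_mul, hXX]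
    simp [hρ]
  have hind : IndepFun X Z P := hXZ.indepFun_of_covariance_eq_zero hcov
  have hind2 : IndepFun (fun ω => X ω ^ m - c) (fun ω => Z ω ^ m - c) P :=
    hind.comp (φ := fun x => x ^ m - c) (ψ := fun x => x ^ m - c) (by fun_prop) (by fun_prop)
  have lX : MemLp (fun ω => X ω ^ m - c) 2 P := (memLp_pow hX m).sub (memLp_const c)
  have lY : MemLp (fun ω => Y ω ^ m) 2 P := memLp_pow hY m
  have lZ : MemLp (fun ω => Z ω ^ m) 2 P := memLp_pow hZ m
  have lZc : MemLp (fun ω => Z ω ^ m - c) 2 P := lZ.sub (memLp_const c)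
  have hz : ∫ ω, (X ω ^ m - c) * (Z ω ^ m - c) ∂P = 0 := by
    rw [hind2.integral_fun_mul_eq_mul_integral lX.1 lZc.1,
      integral_sub (integrable_pow hX m) (integrable_const c), integral_pow_std hX hX1]
    simp [← hc]
  have i1 : Integrable (fun ω => (X ω ^ m - c) * (Y ω ^ m - Z ω ^ m)) P :=
    lX.integrable_mul (lY.sub lZ)
  have i2 : Integrable (fun ω => (X ω ^ m - c) * (Z ω ^ m - c)) P := lX.integrable_mul lZc
  have hsplit : ∫ ω, (X ω ^ m - c) * (Y ω ^ m - c) ∂P =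
      ∫ ω, (X ω ^ m - c) * (Y ω ^ m - Z ω ^ m) ∂P := by
    rw [← add_zero (∫ ω, (X ω ^ m - c) * (Y ω ^ m - Z ω ^ m) ∂P), ← hz, ← integral_add i1 i2]
    congr 1; ext ω; ring
  rw [hsplit]
  have iX := integrable_pow hX (2 * m)
  have iY := integrable_pow hY (2 * m)
  have hbound : ∀ ω, ‖(X ω ^ m - c) * (Y ω ^ m - Z ω ^ m)‖ ≤
      (m * (1 + |c|) * |ρ| * 3 ^ (2 * m)) * (1 + X ω ^ (2 * m) + Y ω ^ (2 * m)) := by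
    intro ω
    set S := 1 + |X ω| + |Y ω| with hS
    have aX := abs_nonneg (X ω)
    have aY := abs_nonneg (Y ω)
    have ac := abs_nonneg c
    have S1 : 1 ≤ S := by linarith
    have b1 : |X ω ^ m - c| ≤ (1 + |c|) * S ^ m := by
      have h1 : |X ω| ^ m ≤ S ^ m := by gcongr; linarith
      have h2 : 1 ≤ S ^ m := one_le_pow₀ S1
      calc |X ω ^ m - c| ≤ |X ω ^ m| + |c| := abs_sub _ _
        _ = |X ω| ^ m + |c| := by rw [abs_pow]
        _ ≤ S ^ m + |c| * S ^ m := by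
          gcongr; exact le_mul_of_one_le_right ac h2
        _ = _ := by ring
    have b2 : |Y ω ^ m - Z ω ^ m| ≤ |ρ| * m * S ^ m := by
      have h0 := abs_pow_sub_pow_le (Y ω) (Z ω) m
      have h1 : |Y ω - Z ω| = |ρ| * |X ω| := by simp [Z, abs_mul]
      have hZ' : |Z ω| ≤ S := by
        calc |Z ω| ≤ |Y ω| + |ρ * X ω| := abs_sub _ _
          _ = |Y ω| + |ρ| * |X ω| := by rw [abs_mul]
          _ ≤ |Y ω| + 1 * |X ω| := by gcongr
          _ ≤ S := by rw [hS]; linarith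
      have h2 : max |Y ω| |Z ω| ≤ S := max_le (by linarith) hZ'
      rcases Nat.eq_zero_or_pos m with rfl | hm
      · simp
      calc |Y ω ^ m - Z ω ^ m| ≤ |Y ω - Z ω| * m * max |Y ω| |Z ω| ^ (m - 1) := h0
        _ ≤ (|ρ| * S) * m * S ^ (m - 1) := by
          rw [h1]; gcongr; linarith
        _ = |ρ| * m * (S ^ (m - 1) * S) := by ring
        _ = |ρ| * m * S ^ m := by rw [← pow_succ, Nat.sub_add_cancel hm]
    have b3 : S ^ (2 * m) ≤ 3 ^ (2 * m) * (1 + X ω ^ (2 * m) + Y ω ^ (2 * m)) := by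
      have e1 : |X ω| ^ (2 * m) = X ω ^ (2 * m) := by rw [pow_mul, sq_abs, pow_mul]
      have e2 : |Y ω| ^ (2 * m) = Y ω ^ (2 * m) := by rw [pow_mul, sq_abs, pow_mul]
      rw [← e1, ← e2]
      have p1 : 0 ≤ |X ω| ^ (2 * m) := by positivity
      have p2 : 0 ≤ |Y ω| ^ (2 * m) := by positivity
      have hT : ∃ t : ℝ, 0 ≤ t ∧ S ≤ 3 * t ∧ t ^ (2 * m) ≤ 1 + |X ω| ^ (2 * m) + |Y ω| ^ (2 * m) := by
        by_cases c1 : |X ω| ≤ 1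
        · by_cases c2 : |Y ω| ≤ 1
          · exact ⟨1, by norm_num, by linarith, by rw [one_pow]; linarith⟩
          · exact ⟨|Y ω|, aY, by linarith, by linarith⟩
        · by_cases c2 : |Y ω| ≤ |X ω|
          · exact ⟨|X ω|, aX, by linarith, by linarith⟩
          · exact ⟨|Y ω|, aY, by linarith, by linarith⟩
      obtain ⟨t, ht0, ht1, ht2⟩ := hT
      calc S ^ (2 * m) ≤ (3 * t) ^ (2 * m) := by gcongr
        _ = 3 ^ (2 * m) * t ^ (2 * m) := mul_pow _ _ _
        _ ≤ _ := by gcongr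
    rw [norm_mul, Real.norm_eq_abs, Real.norm_eq_abs]
    calc |X ω ^ m - c| * |Y ω ^ m - Z ω ^ m|
        ≤ ((1 + |c|) * S ^ m) * (|ρ| * m * S ^ m) := by gcongr
      _ = (m * (1 + |c|) * |ρ|) * S ^ (2 * m) := by rw [two_mul, pow_add]; ring
      _ ≤ (m * (1 + |c|) * |ρ|) * (3 ^ (2 * m) * (1 + X ω ^ (2 * m) + Y ω ^ (2 * m))) := by
        gcongr
      _ = _ := by ring
  have i3 : Integrable (fun ω => 1 + X ω ^ (2 * m) + Y ω ^ (2 * m)) P :=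
    ((integrable_const 1).add iX).add iY
  have e3 : ∫ ω, (1 + X ω ^ (2 * m) + Y ω ^ (2 * m)) ∂P = 1 + 2 * d := by
    have i4 : Integrable (fun ω => 1 + X ω ^ (2 * m)) P := (integrable_const 1).add iX
    rw [integral_add i4 iY, integral_add (integrable_const 1) iX,
      integral_pow_std hX hX1, integral_pow_std hY hY1]
    simp [← hd]; ring
  have := norm_integral_le_of_norm_le (i3.const_mul (m * (1 + |c|) * |ρ| * 3 ^ (2 * m)))
    (Eventually.of_forall hbound)
  rw [integral_const_mul, e3] at this
  rw [Real.norm_eq_abs] at this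
  refine this.trans_eq ?_
  rw [covConst, ← hc, ← hd]; ring

end PV

namespace PV

/-- Correlation function of fractional Gaussian noise. -/
noncomputable def rho (H x : ℝ) : ℝ :=
  (|x + 1| ^ (2 * H) + |x - 1| ^ (2 * H) - 2 * |x| ^ (2 * H)) / 2

lemma rho_neg (H x : ℝ) : rho H (-x) = rho H x := by
  unfold rho
  have e1 : |-x + 1| = |x - 1| := by rw [← abs_neg]; congr 1; ring
  have e2 : |-x - 1| = |x + 1| := by rw [← abs_neg]; congr 1; ring
  rw [e1, e2, abs_neg]; ring

lemma rho_upper {H x : ℝ} (h0 : 0 < H) (h1 : H < 1) (hx : 1 ≤ x) :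
    rho H x ≤ H * x ^ (2 * H - 2) := by
  have hx0 : 0 < x := by linarith
  unfold rho
  rw [abs_of_nonneg (by linarith : 0 ≤ x + 1), abs_of_nonneg (by linarith : 0 ≤ x - 1),
    abs_of_pos hx0]
  have e : ∀ y : ℝ, 0 ≤ y → y ^ (2 * H) = (y ^ 2) ^ H := fun y hy => by
    rw [Real.rpow_mul hy, Real.rpow_two]
  have hc := (Real.concaveOn_rpow h0.le h1.le).2
    (show (x + 1) ^ 2 ∈ Set.Ici (0 : ℝ) from Set.mem_Ici.2 (sq_nonneg _))
    (show (x - 1) ^ 2 ∈ Set.Ici (0 : ℝ) from Set.mem_Ici.2 (sq_nonneg _))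
    (show (0 : ℝ) ≤ 1 / 2 by norm_num) (show (0 : ℝ) ≤ 1 / 2 by norm_num) (by norm_num)
  simp only [smul_eq_mul] at hc
  have e1 : 1 / 2 * (x + 1) ^ 2 + 1 / 2 * (x - 1) ^ 2 = x ^ 2 * (1 + 1 / x ^ 2) := by
    field_simp; ring
  rw [e1, Real.mul_rpow (by positivity) (by positivity), ← e _ (by linarith),
    ← e _ (by linarith), ← e _ hx0.le] at hc
  have hb := rpow_one_add_le_one_add_mul_self (s := 1 / x ^ 2) (p := H)
    (by have : 0 ≤ 1 / x ^ 2 := by positivity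
        linarith) h0.le h1.le
  have hxp : 0 < x ^ (2 * H) := by positivity
  have e2 : x ^ (2 * H - 2) = x ^ (2 * H) / x ^ 2 := by
    rw [Real.rpow_sub hx0, Real.rpow_two]
  have h3 : x ^ (2 * H) * (1 + 1 / x ^ 2) ^ H ≤ x ^ (2 * H) * (1 + H * (1 / x ^ 2)) := by gcongr
  rw [e2]
  have e3 : x ^ (2 * H) * (1 + H * (1 / x ^ 2)) = x ^ (2 * H) + H * (x ^ (2 * H) / x ^ 2) := by
    ring
  linarith

lemma rho_lower1 {H x : ℝ} (h1 : 1 ≤ 2 * H) (hx : 1 ≤ x) : 0 ≤ rho H x := by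
  have hx0 : 0 < x := by linarith
  unfold rho
  rw [abs_of_nonneg (by linarith : 0 ≤ x + 1), abs_of_nonneg (by linarith : 0 ≤ x - 1),
    abs_of_pos hx0]
  have hc := (convexOn_rpow h1).2
    (show x + 1 ∈ Set.Ici (0 : ℝ) from by simp; linarith)
    (show x - 1 ∈ Set.Ici (0 : ℝ) from by simp; linarith)
    (show (0 : ℝ) ≤ 1 / 2 by norm_num) (show (0 : ℝ) ≤ 1 / 2 by norm_num) (by norm_num)
  simp only [smul_eq_mul] at hc
  have e1 : 1 / 2 * (x + 1) + 1 / 2 * (x - 1) = x := by ring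
  rw [e1] at hc
  linarith

lemma rho_lower2 {H x : ℝ} (h0 : 0 < H) (h1 : 2 * H < 1) (hx : 1 < x) :
    - x ^ (2 * H - 1) ≤ rho H x := by
  have hx0 : 0 < x := by linarith
  unfold rho
  rw [abs_of_nonneg (by linarith : 0 ≤ x + 1), abs_of_nonneg (by linarith : 0 ≤ x - 1),
    abs_of_pos hx0]
  have a1 : x ^ (2 * H) ≤ (x + 1) ^ (2 * H) :=
    Real.rpow_le_rpow hx0.le (by linarith) (by linarith)
  have a2 : x ^ (2 * H - 1) ≤ (x - 1) ^ (2 * H - 1) :=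
    Real.rpow_le_rpow_of_nonpos (by linarith) (by linarith) (by linarith)
  have e1 : (x - 1) ^ (2 * H) = (x - 1) ^ (2 * H - 1) * (x - 1) := by
    rw [Real.rpow_sub_one (by linarith)]; field_simp [show x - 1 ≠ 0 by linarith]
  have e2 : x ^ (2 * H) = x ^ (2 * H - 1) * x := by
    rw [Real.rpow_sub_one (by linarith)]; field_simp
  have a3 : x ^ (2 * H - 1) * (x - 1) ≤ (x - 1) ^ (2 * H - 1) * (x - 1) :=
    mul_le_mul_of_nonneg_right a2 (by linarith)
  have a4 : 0 < x ^ (2 * H - 1) := by positivity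
  nlinarith

lemma rho_tendsto {H : ℝ} (h0 : 0 < H) (h1 : H < 1) :
    Tendsto (fun j : ℕ => |rho H j|) atTop (nhds 0) := by
  have ha : Tendsto (fun j : ℕ => H * (j : ℝ) ^ (2 * H - 2)) atTop (nhds 0) := by
    have := (tendsto_rpow_neg_atTop (y := 2 - 2 * H) (by linarith)).comp
      (tendsto_natCast_atTop_atTop (R := ℝ))
    have := this.const_mul H
    simpa [Function.comp_def] using this
  suffices Tendsto (fun j : ℕ => rho H j) atTop (nhds 0) by simpa using this.abs
  by_cases hH : 1 ≤ 2 * H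
  · refine tendsto_of_tendsto_of_tendsto_of_le_of_le' tendsto_const_nhds ha ?_ ?_
    · filter_upwards [eventually_ge_atTop 1] with j hj
      exact rho_lower1 hH (by exact_mod_cast hj)
    · filter_upwards [eventually_ge_atTop 1] with j hj
      exact rho_upper h0 h1 (by exact_mod_cast hj)
  · push Not at hH
    have hb : Tendsto (fun j : ℕ => - (j : ℝ) ^ (2 * H - 1)) atTop (nhds 0) := by
      have := (tendsto_rpow_neg_atTop (y := 1 - 2 * H) (by linarith)).comp
        (tendsto_natCast_atTop_atTop (R := ℝ))
      simpa [Function.comp_def] using this.neg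
    refine tendsto_of_tendsto_of_tendsto_of_le_of_le' hb ha ?_ ?_
    · filter_upwards [eventually_ge_atTop 2] with j hj
      exact rho_lower2 h0 hH (by exact_mod_cast hj)
    · filter_upwards [eventually_ge_atTop 1] with j hj
      exact rho_upper h0 h1 (by exact_mod_cast hj)

lemma row_sum (H : ℝ) (n k : ℕ) (hk : k < n) :
    ∑ l ∈ range n, |rho H ((k : ℝ) - l)| ≤ 2 * ∑ j ∈ range n, |rho H j| := by
  have hpt : ∀ l ∈ range n, |rho H ((k : ℝ) - l)| ≤
      (if l ≤ k then |rho H ((k - l : ℕ) : ℝ)| else 0) +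
      (if k ≤ l then |rho H ((l - k : ℕ) : ℝ)| else 0) := by
    intro l _
    rcases le_total l k with h | h
    · rw [if_pos h, Nat.cast_sub h]
      have : 0 ≤ (if k ≤ l then |rho H ((l - k : ℕ) : ℝ)| else 0) := by
        split_ifs <;> positivity
      linarith
    · rw [if_pos h, Nat.cast_sub h]
      have : 0 ≤ (if l ≤ k then |rho H ((k - l : ℕ) : ℝ)| else 0) := by
        split_ifs <;> positivity
      have e : rho H ((k : ℝ) - l) = rho H ((l : ℝ) - k) := by
        rw [← rho_neg]; congr 1; ring
      rw [e]; linarith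
  refine (sum_le_sum hpt).trans ?_
  rw [sum_add_distrib, two_mul, ← sum_filter, ← sum_filter]
  gcongr ?_ + ?_
  · rw [← sum_image (f := fun j : ℕ => |rho H j|) (g := fun l => k - l)]
    · refine sum_le_sum_of_subset_of_nonneg ?_ (fun _ _ _ => abs_nonneg _)
      intro j hj
      simp only [mem_image, mem_filter, mem_range] at hj ⊢
      omega
    · intro a ha b hb hab
      simp at ha hb hab
      omega
  · rw [← sum_image (f := fun j : ℕ => |rho H j|) (g := fun l => l - k)]
    · refine sum_le_sum_of_subset_of_nonneg ?_ (fun _ _ _ => abs_nonneg _)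
      intro j hj
      simp only [mem_image, mem_filter, mem_range] at hj ⊢
      omega
    · intro a ha b hb hab
      simp at ha hb hab
      omega

lemma double_sum {H : ℝ} (h0 : 0 < H) (h1 : H < 1) :
    Tendsto (fun n : ℕ => ((n : ℝ) ^ 2)⁻¹ *
      ∑ k ∈ range n, ∑ l ∈ range n, |rho H ((k : ℝ) - l)|) atTop (nhds 0) := by
  have hc := (rho_tendsto h0 h1).cesaro.const_mul 2
  rw [mul_zero] at hc
  refine squeeze_zero (fun n => by positivity) (fun n => ?_) hc
  calc ((n : ℝ) ^ 2)⁻¹ * ∑ k ∈ range n, ∑ l ∈ range n, |rho H ((k : ℝ) - l)|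
      ≤ ((n : ℝ) ^ 2)⁻¹ * ∑ k ∈ range n, 2 * ∑ j ∈ range n, |rho H j| := by
        gcongr with k hk
        exact row_sum H n k (by simpa using hk)
    _ = 2 * ((n : ℝ)⁻¹ * ∑ j ∈ range n, |rho H j|) := by
        rw [sum_const, card_range, nsmul_eq_mul]
        rcases Nat.eq_zero_or_pos n with rfl | hn
        · simp
        · field_simp

end PV

namespace PV

/-- The hypotheses on the process, bundled for internal use. -/
structure FBM {Ω : Type*} {mΩ : MeasurableSpace Ω} (P : Measure Ω) (H : ℝ) (B : ℝ → Ω → ℝ) :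
    Prop where
  prob : IsProbabilityMeasure P
  h0 : 0 < H
  h1 : H < 1
  meas : ∀ t, Measurable (B t)
  gauss : ∀ (p : ℕ) (t : Fin p → ℝ) (a : Fin p → ℝ),
      (∀ i, t i ∈ Set.Icc (0 : ℝ) 1) →
      ∃ v : NNReal, Measure.map (fun ω => ∑ i, a i * B (t i) ω) P = gaussianReal 0 v
  cov : ∀ s ∈ Set.Icc (0 : ℝ) 1, ∀ t ∈ Set.Icc (0 : ℝ) 1,
      ∫ ω, B s ω * B t ω ∂P =
        (s ^ (2 * H) + t ^ (2 * H) - |t - s| ^ (2 * H)) / 2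

variable {Ω : Type*} {mΩ : MeasurableSpace Ω} {P : Measure Ω} {H : ℝ} {B : ℝ → Ω → ℝ}

lemma FBM.pair (hB : FBM P H B) {s t u v : ℝ} (hs : s ∈ Set.Icc (0 : ℝ) 1)
    (ht : t ∈ Set.Icc (0 : ℝ) 1) (hu : u ∈ Set.Icc (0 : ℝ) 1) (hv : v ∈ Set.Icc (0 : ℝ) 1)
    (a b : ℝ) :
    HasGaussianLaw (fun ω => (a * (B t ω - B s ω), b * (B v ω - B u ω))) P := by
  have hm := hB.meas
  constructor
  apply isGaussian_of_map_eq_gaussianReal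
  intro L
  obtain ⟨w, hw⟩ := hB.gauss 4 ![s, t, u, v]
    ![-(L (1, 0) * a), L (1, 0) * a, -(L (0, 1) * b), L (0, 1) * b]
    (by intro i; fin_cases i <;> simp_all)
  refine ⟨0, w, ?_⟩
  rw [← hw, Measure.map_map (by fun_prop) (by fun_prop)]
  congr 1
  ext ω
  have hL : ∀ x y : ℝ, L (x, y) = x * L (1, 0) + y * L (0, 1) := by
    intro x y
    have : ((x, y) : ℝ × ℝ) = x • (1, 0) + y • (0, 1) := by simp
    rw [this, map_add, map_smul, map_smul, smul_eq_mul, smul_eq_mul]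
  rw [Function.comp_apply, hL]
  simp [Fin.sum_univ_four]
  ring

lemma FBM.single (hB : FBM P H B) {s : ℝ} (hs : s ∈ Set.Icc (0 : ℝ) 1) :
    HasGaussianLaw (B s) P := by
  obtain ⟨v, hv⟩ := hB.gauss 1 (fun _ => s) (fun _ => 1) (fun _ => hs)
  constructor
  simp only [Fin.sum_univ_one, one_mul] at hv
  have : Measure.map (B s) P = gaussianReal 0 v := hv
  rw [this]; infer_instance

lemma FBM.incr_cov (hB : FBM P H B) {s t u v : ℝ} (hs : s ∈ Set.Icc (0 : ℝ) 1)
    (ht : t ∈ Set.Icc (0 : ℝ) 1) (hu : u ∈ Set.Icc (0 : ℝ) 1) (hv : v ∈ Set.Icc (0 : ℝ) 1) :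
    ∫ ω, (B t ω - B s ω) * (B v ω - B u ω) ∂P =
      (|v - s| ^ (2 * H) + |u - t| ^ (2 * H) - |v - t| ^ (2 * H) - |u - s| ^ (2 * H)) / 2 := by
  have i : ∀ x ∈ Set.Icc (0 : ℝ) 1, ∀ y ∈ Set.Icc (0 : ℝ) 1,
      Integrable (fun ω => B x ω * B y ω) P := fun x hx y hy =>
    (hB.single hx).memLp_two.integrable_mul (hB.single hy).memLp_two
  have e : ∀ ω, (B t ω - B s ω) * (B v ω - B u ω) =
      (B t ω * B v ω - B t ω * B u ω) - (B s ω * B v ω - B s ω * B u ω) := fun ω => by ring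
  simp_rw [e]
  have j1 : Integrable (fun ω => B t ω * B v ω - B t ω * B u ω) P := (i t ht v hv).sub (i t ht u hu)
  have j2 : Integrable (fun ω => B s ω * B v ω - B s ω * B u ω) P := (i s hs v hv).sub (i s hs u hu)
  rw [integral_sub j1 j2,
    integral_sub (i t ht v hv) (i t ht u hu), integral_sub (i s hs v hv) (i s hs u hu),
    hB.cov t ht v hv, hB.cov t ht u hu, hB.cov s hs v hv, hB.cov s hs u hu]
  ring

lemma FBM.incr_sq (hB : FBM P H B) {s t : ℝ} (hs : s ∈ Set.Icc (0 : ℝ) 1)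
    (ht : t ∈ Set.Icc (0 : ℝ) 1) :
    ∫ ω, (B t ω - B s ω) ^ 2 ∂P = |t - s| ^ (2 * H) := by
  simp_rw [pow_two]
  rw [hB.incr_cov hs ht hs ht]
  have : (2 * H) ≠ 0 := by have := hB.h0; positivity
  simp [Real.zero_rpow this]
  rw [abs_sub_comm s t]; ring

/-- Normalised increments. -/
noncomputable def incr (H : ℝ) (B : ℝ → Ω → ℝ) (n k : ℕ) (ω : Ω) : ℝ :=
  (n : ℝ) ^ H * (B (((k : ℝ) + 1) / n) ω - B ((k : ℝ) / n) ω)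

lemma mem1 {n k : ℕ} (hk : k < n) : (k : ℝ) / n ∈ Set.Icc (0 : ℝ) 1 := by
  have : (0 : ℝ) < n := by exact_mod_cast (by omega : 0 < n)
  refine ⟨by positivity, ?_⟩
  rw [div_le_one this]; exact_mod_cast hk.le

lemma mem2 {n k : ℕ} (hk : k < n) : ((k : ℝ) + 1) / n ∈ Set.Icc (0 : ℝ) 1 := by
  have : (0 : ℝ) < n := by exact_mod_cast (by omega : 0 < n)
  refine ⟨by positivity, ?_⟩
  rw [div_le_one this]; exact_mod_cast hk

lemma FBM.incr_pair (hB : FBM P H B) {n k l : ℕ} (hk : k < n) (hl : l < n) :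
    HasGaussianLaw (fun ω => (incr H B n k ω, incr H B n l ω)) P :=
  hB.pair (mem1 hk) (mem2 hk) (mem1 hl) (mem2 hl) _ _

lemma FBM.incr_rho (hB : FBM P H B) {n k l : ℕ} (hk : k < n) (hl : l < n) :
    ∫ ω, incr H B n k ω * incr H B n l ω ∂P = rho H ((k : ℝ) - l) := by
  have hn : (0 : ℝ) < n := by exact_mod_cast (by omega : 0 < n)
  have e : ∀ ω, incr H B n k ω * incr H B n l ω = (n : ℝ) ^ (2 * H) *
      ((B (((k : ℝ) + 1) / n) ω - B ((k : ℝ) / n) ω) *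
        (B (((l : ℝ) + 1) / n) ω - B ((l : ℝ) / n) ω)) := by
    intro ω
    rw [two_mul, Real.rpow_add hn]; unfold incr; ring
  simp_rw [e]
  rw [integral_const_mul, hB.incr_cov (mem1 hk) (mem2 hk) (mem1 hl) (mem2 hl)]
  have key : ∀ x : ℝ, (n : ℝ) ^ (2 * H) * |x / n| ^ (2 * H) = |x| ^ (2 * H) := by
    intro x
    rw [← Real.mul_rpow hn.le (abs_nonneg _), abs_div, abs_of_pos hn]
    congr 1; field_simp
  have d1 : ((l : ℝ) + 1) / n - k / n = (-((k : ℝ) - l - 1)) / n := by ring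
  have d2 : (l : ℝ) / n - ((k : ℝ) + 1) / n = (-((k : ℝ) - l + 1)) / n := by ring
  have d3 : ((l : ℝ) + 1) / n - ((k : ℝ) + 1) / n = (-((k : ℝ) - l)) / n := by ring
  have d4 : (l : ℝ) / n - (k : ℝ) / n = (-((k : ℝ) - l)) / n := by ring
  rw [d1, d2, d3, d4, ← mul_div_assoc, mul_sub, mul_sub, mul_add, key, key, key,
    abs_neg, abs_neg, abs_neg]
  unfold rho; ring

lemma FBM.incr_law (hB : FBM P H B) {n k : ℕ} (hk : k < n) :
    P.map (incr H B n k) = gaussianReal 0 1 := by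
  have hn : (0 : ℝ) < n := by exact_mod_cast (by omega : 0 < n)
  have hg : HasGaussianLaw (incr H B n k) P := (hB.incr_pair hk hk).fst
  have hP := hB.prob
  have hm0 : ∫ ω, incr H B n k ω ∂P = 0 := by
    obtain ⟨v, hv⟩ := hB.gauss 2 ![((k : ℝ) + 1) / n, (k : ℝ) / n] ![(n : ℝ) ^ H, -(n : ℝ) ^ H]
      (by intro i; fin_cases i
          · exact mem2 hk
          · exact mem1 hk)
    have e : (fun ω => ∑ i, ![(n : ℝ) ^ H, -(n : ℝ) ^ H] i *
        B (![((k : ℝ) + 1) / n, (k : ℝ) / n] i) ω) = incr H B n k := by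
      ext ω; simp [Fin.sum_univ_two, incr]; ring
    rw [e] at hv
    rw [← integral_id_gaussianReal (μ := 0) (v := v), ← hv,
      integral_map hg.aemeasurable (by fun_prop)]
  have hv1 : Var[incr H B n k; P] = 1 := by
    rw [variance_eq_sub hg.memLp_two, hm0]
    have := hB.incr_rho hk hk
    simp only [← pow_two] at this
    have h2 : (2 * H) ≠ 0 := by have := hB.h0; positivity
    simp only [Pi.pow_apply, this]
    simp [rho, Real.zero_rpow h2]
  rw [hg.map_eq_gaussianReal, hm0, hv1]; simp

end PV

namespace PV
variable {Ω : Type*} {mΩ : MeasurableSpace Ω} {P : Measure Ω} {H : ℝ} {B : ℝ → Ω → ℝ}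

/-- Centred powers of normalised increments. -/
noncomputable def W (H : ℝ) (B : ℝ → Ω → ℝ) (m n k : ℕ) (ω : Ω) : ℝ :=
  incr H B n k ω ^ m - ∫ x, x ^ m ∂(gaussianReal 0 1)

/-- `L²` norm of a centred power. -/
noncomputable def wConst (m : ℕ) : ℝ :=
  √(∫ x, (x ^ m - ∫ y, y ^ m ∂(gaussianReal 0 1)) ^ 2 ∂(gaussianReal 0 1))

/-- The double sum of correlations. -/
noncomputable def S (H : ℝ) (n : ℕ) : ℝ :=
  ∑ k ∈ range n, ∑ l ∈ range n, |rho H ((k : ℝ) - l)|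

lemma FBM.incr_g (hB : FBM P H B) {n k : ℕ} (hk : k < n) :
    HasGaussianLaw (incr H B n k) P := (hB.incr_pair hk hk).fst

lemma FBM.W_memLp (hB : FBM P H B) (m : ℕ) {n k : ℕ} (hk : k < n) :
    MemLp (W H B m n k) 2 P := by
  have := hB.prob
  exact (memLp_pow (hB.incr_g hk) m).sub (memLp_const _)

lemma FBM.W_sq (hB : FBM P H B) (m : ℕ) {n k : ℕ} (hk : k < n) :
    √(∫ ω, W H B m n k ω ^ 2 ∂P) = wConst m := by
  unfold wConst
  rw [← hB.incr_law hk, integral_map (hB.incr_g hk).aemeasurable (by fun_prop)]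
  rw [hB.incr_law hk]
  rfl

lemma covConst_nonneg (m : ℕ) : 0 ≤ covConst m := by
  unfold covConst
  have : 0 ≤ ∫ x, x ^ (2 * m) ∂(gaussianReal 0 1) :=
    integral_nonneg fun x => by simp only [pow_mul]; positivity
  positivity

lemma FBM.block (hB : FBM P H B) (m : ℕ) {n : ℕ} (s : Finset ℕ) (hs : s ⊆ range n) :
    ∫ ω, (∑ k ∈ s, W H B m n k ω) ^ 2 ∂P ≤ covConst m * S H n := by
  have hk : ∀ k ∈ s, k < n := fun k hk => by simpa using hs hk
  have e : ∀ ω, (∑ k ∈ s, W H B m n k ω) ^ 2 =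
      ∑ k ∈ s, ∑ l ∈ s, W H B m n k ω * W H B m n l ω := by
    intro ω; rw [pow_two, sum_mul_sum]
  have i : ∀ k ∈ s, ∀ l ∈ s, Integrable (fun ω => W H B m n k ω * W H B m n l ω) P :=
    fun k hk' l hl' => (hB.W_memLp m (hk k hk')).integrable_mul (hB.W_memLp m (hk l hl'))
  simp_rw [e]
  rw [integral_finsetSum _ (fun k hk' => integrable_finsetSum _ (fun l hl' => i k hk' l hl'))]
  have : ∀ k ∈ s, ∫ ω, ∑ l ∈ s, W H B m n k ω * W H B m n l ω ∂P ≤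
      ∑ l ∈ s, covConst m * |rho H ((k : ℝ) - l)| := by
    intro k hk'
    rw [integral_finsetSum _ (fun l hl' => i k hk' l hl')]
    refine sum_le_sum fun l hl' => ?_
    have := cov_bound (hB.incr_pair (hk k hk') (hk l hl')) (hB.incr_law (hk k hk'))
      (hB.incr_law (hk l hl')) m
    rw [hB.incr_rho (hk k hk') (hk l hl')] at this
    exact (le_abs_self _).trans this
  refine (sum_le_sum this).trans ?_
  unfold S
  simp_rw [← mul_sum]
  refine mul_le_mul_of_nonneg_left ?_ (covConst_nonneg m)
  calc ∑ k ∈ s, ∑ l ∈ s, |rho H ((k : ℝ) - l)|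
      ≤ ∑ k ∈ s, ∑ l ∈ range n, |rho H ((k : ℝ) - l)| := by
        refine sum_le_sum fun k _ => ?_
        exact sum_le_sum_of_subset_of_nonneg hs (fun _ _ _ => abs_nonneg _)
    _ ≤ _ := sum_le_sum_of_subset_of_nonneg hs
        (fun _ _ _ => sum_nonneg fun _ _ => abs_nonneg _)

lemma FBM.main_est (hB : FBM P H B) (m : ℕ) {n p : ℕ} (hn : 0 < n) (hp : 0 < p)
    {h : ℝ → ℝ} (hc : Continuous h) {C : ℝ} (hb : ∀ x, |h x| ≤ C)
    (hl : ∀ x y, |h x - h y| ≤ C * |x - y|) :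
    Integrable (fun ω => (n : ℝ)⁻¹ * ∑ k ∈ range n, h (B ((k : ℝ) / n) ω) * W H B m n k ω) P ∧
    ∫ ω, |(n : ℝ)⁻¹ * ∑ k ∈ range n, h (B ((k : ℝ) / n) ω) * W H B m n k ω| ∂P ≤
      C * wConst m * (p : ℝ)⁻¹ ^ H + C * p * √(covConst m * (((n : ℝ) ^ 2)⁻¹ * S H n)) := by
  have hP := hB.prob
  have hC : 0 ≤ C := (abs_nonneg _).trans (hb 0)
  have hn' : (0 : ℝ) < n := by exact_mod_cast hn
  have hp' : (0 : ℝ) < p := by exact_mod_cast hp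
  let j : ℕ → ℕ := fun k => k * p / n
  have hj : ∀ k ∈ range n, j k ∈ range p := by
    intro k hk
    simp only [mem_range, j] at hk ⊢
    rw [Nat.div_lt_iff_lt_mul hn, mul_comm]
    exact Nat.mul_lt_mul_of_pos_left hk hp
  have hjd : ∀ k : ℕ, |(k : ℝ) / n - (j k : ℝ) / p| ≤ (p : ℝ)⁻¹ := by
    intro k
    have h1 : (j k : ℝ) * n ≤ k * p := by exact_mod_cast Nat.div_mul_le_self (k * p) n
    have h2 : (k : ℝ) * p < (j k + 1) * n := by
      exact_mod_cast (Nat.div_lt_iff_lt_mul hn).1 (Nat.lt_succ_self (k * p / n))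
    have e : (k : ℝ) / n - (j k : ℝ) / p = (k * p - j k * n) / (n * p) := by
      field_simp
    rw [e, abs_of_nonneg (div_nonneg (by linarith) (by positivity)), inv_eq_one_div,
      div_le_div_iff₀ (by positivity) hp']
    nlinarith
  let D : ℕ → Ω → ℝ := fun k ω => B ((k : ℝ) / n) ω - B ((j k : ℝ) / p) ω
  have hDL : ∀ k ∈ range n, MemLp (D k) 2 P := fun k hk =>
    (hB.single (mem1 (mem_range.1 hk))).memLp_two.sub
      (hB.single (mem1 (mem_range.1 (hj k hk)))).memLp_two
  have hWL : ∀ k ∈ range n, MemLp (W H B m n k) 2 P := fun k hk =>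
    hB.W_memLp m (mem_range.1 hk)
  let T : ℕ → Ω → ℝ := fun i ω => ∑ k ∈ range n with j k = i, W H B m n k ω
  have hTL : ∀ i, MemLp (T i) 2 P := fun i =>
    memLp_finsetSum _ (fun k hk => hWL k (mem_filter.1 hk).1)
  have hDW : ∀ k ∈ range n, ∫ ω, |D k ω * W H B m n k ω| ∂P ≤ (p : ℝ)⁻¹ ^ H * wConst m := by
    intro k hk
    refine (cauchy_schwarz (hDL k hk) (hWL k hk)).trans ?_
    rw [hB.W_sq m (mem_range.1 hk)]
    refine mul_le_mul_of_nonneg_right ?_ (Real.sqrt_nonneg _)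
    rw [hB.incr_sq (mem1 (mem_range.1 (hj k hk))) (mem1 (mem_range.1 hk))]
    have : |(k : ℝ) / n - (j k : ℝ) / p| ^ (2 * H) = (|(k : ℝ) / n - (j k : ℝ) / p| ^ H) ^ 2 := by
      rw [mul_comm, Real.rpow_mul (abs_nonneg _), Real.rpow_two]
    rw [this, Real.sqrt_sq (by positivity)]
    exact Real.rpow_le_rpow (abs_nonneg _) (hjd k) hB.h0.le
  have hT : ∀ i, ∫ ω, |T i ω| ∂P ≤ √(covConst m * S H n) := by
    intro i
    refine (l1_le_l2 (hTL i)).trans (Real.sqrt_le_sqrt ?_)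
    exact hB.block m _ (filter_subset _ _)
  let G : Ω → ℝ := fun ω => (n : ℝ)⁻¹ * ∑ k ∈ range n, C * |D k ω * W H B m n k ω| +
    (n : ℝ)⁻¹ * ∑ i ∈ range p, C * |T i ω|
  have iDW : ∀ k ∈ range n, Integrable (fun ω => C * |D k ω * W H B m n k ω|) P :=
    fun k hk => (((hDL k hk).integrable_mul (hWL k hk)).abs).const_mul C
  have iT : ∀ i ∈ range p, Integrable (fun ω => C * |T i ω|) P :=
    fun i _ => (((hTL i).integrable (by norm_num)).abs).const_mul C
  have iG1 : Integrable (fun ω => (n : ℝ)⁻¹ * ∑ k ∈ range n, C * |D k ω * W H B m n k ω|) P :=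
    (integrable_finsetSum _ iDW).const_mul _
  have iG2 : Integrable (fun ω => (n : ℝ)⁻¹ * ∑ i ∈ range p, C * |T i ω|) P :=
    (integrable_finsetSum _ iT).const_mul _
  have iG : Integrable G P := iG1.add iG2
  have hpt : ∀ ω, |(n : ℝ)⁻¹ * ∑ k ∈ range n, h (B ((k : ℝ) / n) ω) * W H B m n k ω| ≤ G ω := by
    intro ω
    have e : ∑ k ∈ range n, h (B ((k : ℝ) / n) ω) * W H B m n k ω =
        ∑ k ∈ range n, (h (B ((k : ℝ) / n) ω) - h (B ((j k : ℝ) / p) ω)) * W H B m n k ω +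
        ∑ i ∈ range p, h (B ((i : ℝ) / p) ω) * T i ω := by
      have e2 : ∑ i ∈ range p, h (B ((i : ℝ) / p) ω) * T i ω =
          ∑ k ∈ range n, h (B ((j k : ℝ) / p) ω) * W H B m n k ω := by
        rw [← sum_fiberwise_of_maps_to hj]
        refine sum_congr rfl fun i _ => ?_
        simp only [T, mul_sum]
        refine sum_congr rfl fun k hk => ?_
        rw [(mem_filter.1 hk).2]
      rw [e2, ← sum_add_distrib]
      refine sum_congr rfl fun k _ => by ring
    rw [abs_mul, abs_of_pos (inv_pos.2 hn'), e]
    simp only [G]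
    rw [← mul_add]
    refine mul_le_mul_of_nonneg_left ?_ (by positivity)
    refine (abs_add_le _ _).trans (add_le_add ?_ ?_)
    · refine (abs_sum_le_sum_abs _ _).trans (sum_le_sum fun k _ => ?_)
      rw [abs_mul, abs_mul, ← mul_assoc]
      exact mul_le_mul_of_nonneg_right (hl _ _) (abs_nonneg _)
    · refine (abs_sum_le_sum_abs _ _).trans (sum_le_sum fun i _ => ?_)
      rw [abs_mul]
      exact mul_le_mul_of_nonneg_right (hb _) (abs_nonneg _)
  have hmeas : Measurable
      (fun ω => (n : ℝ)⁻¹ * ∑ k ∈ range n, h (B ((k : ℝ) / n) ω) * W H B m n k ω) := by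
    have := hB.meas
    have := hc.measurable
    unfold W incr
    fun_prop
  have iF := iG.mono' hmeas.aestronglyMeasurable (Eventually.of_forall hpt)
  refine ⟨iF, ?_⟩
  refine (integral_mono iF.abs iG hpt).trans ?_
  simp only [G]
  rw [integral_add iG1 iG2, integral_const_mul, integral_const_mul,
    integral_finsetSum _ iDW, integral_finsetSum _ iT]
  simp_rw [integral_const_mul]
  refine add_le_add ?_ ?_
  · calc (n : ℝ)⁻¹ * ∑ k ∈ range n, C * ∫ ω, |D k ω * W H B m n k ω| ∂P
        ≤ (n : ℝ)⁻¹ * ∑ k ∈ range n, C * ((p : ℝ)⁻¹ ^ H * wConst m) := by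
          refine mul_le_mul_of_nonneg_left (sum_le_sum fun k hk => ?_) (by positivity)
          exact mul_le_mul_of_nonneg_left (hDW k hk) hC
      _ = _ := by
          rw [sum_const, card_range, nsmul_eq_mul]; field_simp
  · calc (n : ℝ)⁻¹ * ∑ i ∈ range p, C * ∫ ω, |T i ω| ∂P
        ≤ (n : ℝ)⁻¹ * ∑ i ∈ range p, C * √(covConst m * S H n) := by
          refine mul_le_mul_of_nonneg_left (sum_le_sum fun k hk => ?_) (by positivity)
          exact mul_le_mul_of_nonneg_left (hT k) hC
      _ = _ := by
          have : covConst m * (((n : ℝ) ^ 2)⁻¹ * S H n) =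
            ((n : ℝ)⁻¹) ^ 2 * (covConst m * S H n) := by rw [inv_pow]; ring
          rw [sum_const, card_range, nsmul_eq_mul, this,
            Real.sqrt_mul (sq_nonneg ((n : ℝ)⁻¹)),
            Real.sqrt_sq (by positivity)]
          ring

lemma FBM.l1_tendsto (hB : FBM P H B) (m : ℕ)
    {h : ℝ → ℝ} (hc : Continuous h) {C : ℝ} (hb : ∀ x, |h x| ≤ C)
    (hl : ∀ x y, |h x - h y| ≤ C * |x - y|) :
    Tendsto (fun n : ℕ => ∫ ω, |(n : ℝ)⁻¹ * ∑ k ∈ range n,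
      h (B ((k : ℝ) / n) ω) * W H B m n k ω| ∂P) atTop (nhds 0) := by
  have hS : ∀ p : ℕ, Tendsto (fun n : ℕ =>
      C * p * √(covConst m * (((n : ℝ) ^ 2)⁻¹ * S H n))) atTop (nhds 0) := by
    intro p
    have := (((double_sum hB.h0 hB.h1).const_mul (covConst m)).sqrt).const_mul (C * p)
    simpa [S] using this
  have hp : Tendsto (fun p : ℕ => C * wConst m * (p : ℝ)⁻¹ ^ H) atTop (nhds 0) := by
    have h1 := (tendsto_inv_atTop_nhds_zero_nat (𝕜 := ℝ)).rpow_const (p := H) (Or.inr hB.h0.le)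
    rw [Real.zero_rpow hB.h0.ne'] at h1
    simpa using h1.const_mul (C * wConst m)
  rw [Metric.tendsto_nhds]
  intro ε hε
  obtain ⟨p, hp1, hp2⟩ := ((hp.eventually (gt_mem_nhds (half_pos hε))).and
    (eventually_gt_atTop 0)).exists
  filter_upwards [(hS p).eventually (gt_mem_nhds (half_pos hε)), eventually_gt_atTop 0]
    with n hn1 hn2
  have := (hB.main_est m hn2 hp2 hc hb hl).2
  rw [Real.dist_eq, sub_zero, abs_of_nonneg (integral_nonneg fun _ => abs_nonneg _)]
  linarith

end PV

namespace PV

lemma riemann {f : ℝ → ℝ} (hf : Continuous f) :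
    Tendsto (fun n : ℕ => (n : ℝ)⁻¹ * ∑ k ∈ range n, f ((k : ℝ) / n)) atTop
      (nhds (∫ s in (0 : ℝ)..1, f s)) := by
  have huc : UniformContinuousOn f (Set.Icc 0 1) :=
    isCompact_Icc.uniformContinuousOn_of_continuous hf.continuousOn
  rw [Metric.uniformContinuousOn_iff] at huc
  rw [Metric.tendsto_nhds]
  intro ε hε
  obtain ⟨δ, hδ, hd⟩ := huc (ε / 2) (half_pos hε)
  have hi := (tendsto_inv_atTop_nhds_zero_nat (𝕜 := ℝ)).eventually (gt_mem_nhds hδ)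
  filter_upwards [hi, eventually_gt_atTop 0] with n hn1 hn
  have hn' : (0 : ℝ) < n := by exact_mod_cast hn
  have e := intervalIntegral.sum_integral_adjacent_intervals (μ := volume) (f := f)
    (a := fun k : ℕ => (k : ℝ) / n) (n := n) (fun k _ => hf.intervalIntegrable _ _)
  simp only [Nat.cast_zero, zero_div, div_self hn'.ne'] at e
  rw [← e, mul_sum, Real.dist_eq, ← sum_sub_distrib]
  have key : ∀ k ∈ range n, |(n : ℝ)⁻¹ * f ((k : ℝ) / n) -
      ∫ x in ((k : ℝ) / n)..(((k + 1 : ℕ) : ℝ) / n), f x| ≤ ε / 2 * (n : ℝ)⁻¹ := by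
    intro k hk
    have hk := mem_range.1 hk
    have e1 : ((k + 1 : ℕ) : ℝ) / n - (k : ℝ) / n = (n : ℝ)⁻¹ := by push_cast; field_simp; ring
    have e2 : (n : ℝ)⁻¹ * f ((k : ℝ) / n) =
        ∫ x in ((k : ℝ) / n)..(((k + 1 : ℕ) : ℝ) / n), f ((k : ℝ) / n) := by
      rw [intervalIntegral.integral_const, e1, smul_eq_mul]
    rw [e2, ← intervalIntegral.integral_sub (by simp) (hf.intervalIntegrable _ _)]
    have := intervalIntegral.norm_integral_le_of_norm_le_const (a := (k : ℝ) / n)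
      (b := ((k + 1 : ℕ) : ℝ) / n) (f := fun x => f ((k : ℝ) / n) - f x) (C := ε / 2) ?_
    · rwa [e1, abs_of_pos (inv_pos.2 hn'), Real.norm_eq_abs] at this
    · intro x hx
      have hle : (k : ℝ) / n ≤ ((k + 1 : ℕ) : ℝ) / n := by
        have := inv_pos.2 hn'
        linarith
      rw [Set.uIoc_of_le hle] at hx
      have m1 := mem1 hk
      have m2 := mem2 hk
      push_cast at hx
      refine (hd _ m1 x ⟨m1.1.trans hx.1.le, hx.2.trans m2.2⟩ ?_).le
      rw [Real.dist_eq, abs_sub_comm, abs_of_nonneg (by linarith [hx.1])]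
      push_cast at e1
      linarith [hx.2]
  refine ((abs_sum_le_sum_abs _ _).trans (sum_le_sum key)).trans_lt ?_
  rw [sum_const, card_range, nsmul_eq_mul]
  have : (n : ℝ) * (ε / 2 * (n : ℝ)⁻¹) = ε / 2 := by field_simp
  linarith

lemma tim_of_l1 {Ω : Type*} {mΩ : MeasurableSpace Ω} {P : Measure Ω} [IsProbabilityMeasure P]
    {F G : ℕ → Ω → ℝ} {g : Ω → ℝ}
    (hF : ∀ᶠ n in atTop, Integrable (F n) P)
    (hF0 : Tendsto (fun n => ∫ ω, |F n ω| ∂P) atTop (nhds 0))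
    (hG : TendstoInMeasure P G atTop g) :
    TendstoInMeasure P (fun n ω => F n ω + G n ω) atTop g := by
  rw [tendstoInMeasure_iff_norm] at hG ⊢
  intro ε hε
  have h2 := hG (ε / 2) (half_pos hε)
  have h1 : Tendsto (fun n => ENNReal.ofReal (2 / ε * ∫ ω, |F n ω| ∂P)) atTop (nhds 0) := by
    have := ENNReal.tendsto_ofReal (hF0.const_mul (2 / ε))
    simpa using this
  have h3 := h1.add h2
  rw [add_zero] at h3
  refine tendsto_of_tendsto_of_tendsto_of_le_of_le' tendsto_const_nhds h3
    (Eventually.of_forall fun _ => zero_le) ?_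
  filter_upwards [hF] with n hn
  have hsub : {x | ε ≤ ‖F n x + G n x - g x‖} ⊆
      {x | ε / 2 ≤ |F n x|} ∪ {x | ε / 2 ≤ ‖G n x - g x‖} := by
    intro x hx
    simp only [Set.mem_ofPred_eq, Set.mem_union, Real.norm_eq_abs] at hx ⊢
    by_contra! hcon
    have := abs_add_le (F n x) (G n x - g x)
    rw [← add_sub_assoc] at this
    linarith
  refine (measure_mono hsub).trans ((measure_union_le _ _).trans ?_)
  gcongr
  have hm := mul_meas_ge_le_integral_of_nonneg (μ := P)
    (Eventually.of_forall fun x => abs_nonneg (F n x)) hn.abs (ε / 2)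
  rw [← ofReal_measureReal (measure_ne_top _ _)]
  apply ENNReal.ofReal_le_ofReal
  rw [div_mul_eq_mul_div, le_div_iff₀ hε]
  linarith

end PV

/-- Weighted even power variation law of large numbers for fractional Brownian motion:
for even `m`, `h ∈ C¹_b`, `n^{mH-1} ∑_{k<n} h(B_{k/n}) (ΔB_{k/n})^m` converges in
probability to `(m!/(2^{m/2}(m/2)!)) ∫₀¹ h(B_s) ds`. -/
theorem stmt_19 {Ω : Type*} [MeasureSpace Ω] [IsProbabilityMeasure (ℙ : Measure Ω)]
    (H : ℝ) (hH : H ∈ Set.Ioo (0 : ℝ) 1)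
    (B : ℝ → Ω → ℝ) (hmeas : ∀ t, Measurable (B t))
    (hcont : ∀ ω, Continuous (fun t => B t ω))
    (hgauss : ∀ (p : ℕ) (t : Fin p → ℝ) (a : Fin p → ℝ),
      (∀ i, t i ∈ Set.Icc (0 : ℝ) 1) →
      ∃ v : NNReal, Measure.map (fun ω => ∑ i, a i * B (t i) ω) ℙ = gaussianReal 0 v)
    (hcov : ∀ s ∈ Set.Icc (0 : ℝ) 1, ∀ t ∈ Set.Icc (0 : ℝ) 1,
      ∫ ω, B s ω * B t ω ∂ℙ =
        (s ^ (2 * H) + t ^ (2 * H) - |t - s| ^ (2 * H)) / 2)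
    (m : ℕ) (hm : Even m)
    (h : ℝ → ℝ) (hh : ContDiff ℝ 1 h)
    (hhb : ∃ C : ℝ, ∀ x, |h x| ≤ C ∧ |deriv h x| ≤ C) :
    TendstoInMeasure ℙ
      (fun (n : ℕ) (ω : Ω) => (n : ℝ) ^ ((m : ℝ) * H - 1) *
        ∑ k ∈ Finset.range n,
          h (B ((k : ℝ) / n) ω) * (B (((k : ℝ) + 1) / n) ω - B ((k : ℝ) / n) ω) ^ m)
      atTop
      (fun ω => ((m.factorial : ℝ) / (2 ^ (m / 2) * ((m / 2).factorial : ℝ))) *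
        ∫ s in (0 : ℝ)..1, h (B s ω)) := by
  obtain ⟨C, hC⟩ := hhb
  have hB : PV.FBM (ℙ : Measure Ω) H B := ⟨inferInstance, hH.1, hH.2, hmeas, hgauss, hcov⟩
  have hc : Continuous h := hh.continuous
  have hl : ∀ x y, |h x - h y| ≤ C * |x - y| := by
    intro x y
    have := Convex.norm_image_sub_le_of_norm_deriv_le (𝕜 := ℝ) (f := h) (s := Set.univ) (C := C)
      (x := y) (y := x) (fun z _ => (hh.differentiable (by norm_num)) z) (fun z _ => (hC z).2)
      convex_univ (Set.mem_univ _) (Set.mem_univ _)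
    simpa using this
  have hb : ∀ x, |h x| ≤ C := fun x => (hC x).1
  rw [← PV.gaussian_moment m hm]
  set c := ∫ x, x ^ m ∂(gaussianReal 0 1) with hcdef
  have hR : TendstoInMeasure (ℙ : Measure Ω)
      (fun (n : ℕ) ω => c * ((n : ℝ)⁻¹ * ∑ k ∈ range n, h (B ((k : ℝ) / n) ω))) atTop
      (fun ω => c * ∫ s in (0 : ℝ)..1, h (B s ω)) := by
    refine tendstoInMeasure_of_tendsto_ae (fun n => ?_) (Eventually.of_forall fun ω => ?_)
    · have := hc.measurable
      exact Measurable.aestronglyMeasurable (by fun_prop)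
    · exact (PV.riemann (hc.comp (hcont ω))).const_mul c
  have hmain := PV.tim_of_l1
    (F := fun (n : ℕ) ω => (n : ℝ)⁻¹ * ∑ k ∈ range n,
      h (B ((k : ℝ) / n) ω) * PV.W H B m n k ω)
    (by filter_upwards [eventually_gt_atTop 0] with n hn
        exact (hB.main_est m hn one_pos hc hb hl).1)
    (hB.l1_tendsto m hc hb hl) hR
  refine hmain.congr' ?_ (by rfl)
  filter_upwards [eventually_gt_atTop 0] with n hn
  refine Eventually.of_forall fun ω => ?_
  have hn' : (0 : ℝ) < n := by exact_mod_cast hn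
  have e1 : (n : ℝ) ^ ((m : ℝ) * H - 1) = (n : ℝ)⁻¹ * ((n : ℝ) ^ H) ^ m := by
    rw [Real.rpow_sub_one hn'.ne', mul_comm (m : ℝ) H, Real.rpow_mul hn'.le, Real.rpow_natCast]
    ring
  simp only
  rw [e1, mul_assoc, mul_left_comm c, ← mul_add, mul_sum, mul_sum, ← sum_add_distrib]
  congr 1
  refine sum_congr rfl fun k _ => ?_
  unfold PV.W PV.incr
  rw [mul_pow]; ring
end
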